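/- Gagliardo-Nirenberg inequality in dimension 2: for p ∈ [2,∞), 0 ≤ s, s₁ ≤ s₂ with s₁ ≤ s, and θ ∈ [0,1] satisfying s + 1 − 2/p = s₁(1−θ) + θ s₂, there is a constant C such that ‖Λ^s f‖_{L^p(ℝ²)} ≤ C ‖Λ^{s₁} f‖_{L²}^{1−θ} ‖Λ^{s₂} f‖_{L²}^{θ} for all Schwartz functions f. -/

import Mathlib

open MeasureTheory
open scoped ENNReal NNReal FourierTransform

/-- Fractional Laplacian `Λ^s f = 𝓕⁻¹(‖ξ‖^s 𝓕 f)` on `ℝ²`. -/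
noncomputable def fracLap (s : ℝ) (f : EuclideanSpace ℝ (Fin 2) → ℂ) :
    EuclideanSpace ℝ (Fin 2) → ℂ :=
  𝓕⁻ fun ξ => ((‖ξ‖ ^ s : ℝ) : ℂ) * 𝓕 f ξ

section GNHelpers
open scoped ContDiff
local notation "E2" => EuclideanSpace ℝ (Fin 2)

theorem cont_neg_inner : Continuous fun p : E2 × E2 => (-innerₗ E2) p.1 p.2 := by
  have := (continuous_inner (𝕜 := ℝ) (E := E2))
  simp only [LinearMap.neg_apply, innerₗ_apply_apply]
  exact this.neg

theorem plancherel_aux (h : E2 → ℂ) (h1 : Integrable h) (h2 : MemLp h 2) :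
    eLpNorm (𝓕⁻ h) 2 volume = eLpNorm h 2 volume := by
  set H : Lp (α := E2) ℂ 2 volume := h2.toLp h with hH
  have hcont : Continuous (𝓕⁻ h) :=
    VectorFourier.fourierIntegral_continuous Real.continuous_fourierChar
      (L := -innerₗ E2) (cont_neg_inner) h1
  have key : ∀ᵐ x, (𝓕⁻ h) x = (𝓕⁻ H : Lp (α := E2) ℂ 2 volume) x := by
    apply ae_eq_of_integral_contDiff_smul_eq
    · exact hcont.locallyIntegrable
    · exact (Lp.memLp _).locallyIntegrable (by norm_num)
    · intro g hg hgs
      have hg' : ContDiff ℝ ∞ (fun x => (g x : ℂ)) := Complex.ofRealCLM.contDiff.comp hg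
      have hgs' : HasCompactSupport (fun x => (g x : ℂ)) := hgs.comp_left (g := fun x : ℝ => (x : ℂ)) (by simp)
      set G : SchwartzMap E2 ℂ := hgs'.toSchwartzMap hg' with hG
      have e := Lp.fourierInv_toTemperedDistribution_eq H
      have e2 := congrArg (fun T => T G) e
      simp only [TemperedDistribution.fourierInv_apply, Lp.toTemperedDistribution_apply] at e2
      have e3 : ∫ x, (𝓕⁻ G) x • H x = ∫ x, (𝓕⁻ G) x • h x := by
        apply integral_congr_ae
        filter_upwards [h2.coeFn_toLp] with x hx
        rw [hx]
      rw [e3] at e2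
      have e4 : ∫ x, (𝓕⁻ G) x • h x = ∫ x, G x • (𝓕⁻ h) x := by
        have := VectorFourier.integral_fourierIntegral_smul_eq_flip (L := -innerₗ E2) (μ := volume) (ν := volume)
          Real.continuous_fourierChar (cont_neg_inner)
          (G.integrable (μ := volume)) h1
        have hf : (-innerₗ E2).flip = -innerₗ E2 := by
          ext x y; simp [real_inner_comm]
        rw [hf] at this
        rw [SchwartzMap.fourierInv_coe]
        exact this
      rw [e4] at e2
      have hGx : ∀ x, G x = (g x : ℂ) := fun x => rfl
      simpa [hGx] using e2
  rw [eLpNorm_congr_ae key, ← eLpNorm_congr_ae h2.coeFn_toLp]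
  have : ‖(𝓕⁻ H : Lp (α := E2) ℂ 2 volume)‖ = ‖H‖ := by
    rw [← Lp.norm_fourier_eq (𝓕⁻ H), FourierTransform.fourier_fourierInv_eq]
  rw [Lp.norm_def, Lp.norm_def, ENNReal.toReal_eq_toReal_iff' (Lp.eLpNorm_ne_top _) (Lp.eLpNorm_ne_top _)] at this
  exact this

theorem rpow_lint {r T : ℝ} (hr : -1 < r) (hT : 0 ≤ T) :
    ∫⁻ t in Set.Ioc 0 T, ENNReal.ofReal (t ^ r) = ENNReal.ofReal (T ^ (r + 1) / (r + 1)) := by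
  rw [← ofReal_integral_eq_lintegral_ofReal]
  · rw [← intervalIntegral.integral_of_le hT, integral_rpow (Or.inl hr), Real.zero_rpow (by linarith)]
    simp
  · exact (intervalIntegral.intervalIntegrable_rpow' hr).1
  · filter_upwards [ae_restrict_mem measurableSet_Ioc] with y hy
    exact Real.rpow_nonneg hy.1.le _

theorem weight_lint {a : ℝ} (ha : a < 1) : ∃ K > 0, ∀ A : ℝ, 0 < A →
    ∫⁻ ξ in Metric.ball (0 : E2) A, ENNReal.ofReal (‖ξ‖ ^ (-2 * a)) ≤ ENNReal.ofReal (K ^ 2 * A ^ (2 - 2 * a)) := by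
  have hV : 0 < volume.real (Metric.ball (0 : E2) 1) := by
    rw [measureReal_def]
    exact ENNReal.toReal_pos (Metric.measure_ball_pos _ _ one_pos).ne' measure_ball_lt_top.ne
  set V := volume.real (Metric.ball (0 : E2) 1) with hVdef
  refine ⟨√(2 * (V / (2 - 2 * a))), Real.sqrt_pos.2 (mul_pos two_pos (div_pos hV (by linarith))), fun A hA => ?_⟩
  rw [Real.sq_sqrt (mul_pos two_pos (div_pos hV (by linarith))).le]
  have hint : IntegrableOn (fun ξ : E2 => ‖ξ‖ ^ (-2 * a)) (Metric.ball 0 A) := by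
    rw [integrableOn_fun_norm_addHaar volume (f := fun y : ℝ => y ^ (-2 * a))]
    have : IntegrableOn (fun y : ℝ => y ^ (1 - 2 * a)) (Set.Ioo 0 A) :=
      (intervalIntegral.intervalIntegrable_rpow' (a := 0) (b := A) (by linarith)).1.mono_set Set.Ioo_subset_Ioc_self
    refine this.congr_fun (fun y hy => ?_) measurableSet_Ioo
    simp only [finrank_euclideanSpace, Fintype.card_fin, Nat.add_one_sub_one, pow_one, smul_eq_mul]
    rw [sub_eq_add_neg, Real.rpow_add hy.1, Real.rpow_one]; ring_nf
  rw [← ofReal_integral_eq_lintegral_ofReal hint (Filter.Eventually.of_forall fun x => Real.rpow_nonneg (norm_nonneg _) _)]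
  apply ENNReal.ofReal_le_ofReal
  rw [← integral_indicator measurableSet_ball]
  have e1 : ∀ ξ : E2, (Metric.ball (0 : E2) A).indicator (fun ξ : E2 => ‖ξ‖ ^ (-2 * a)) ξ
      = (fun y : ℝ => (Set.Iio A).indicator (fun y : ℝ => y ^ (-2 * a)) y) ‖ξ‖ := by
    intro ξ
    simp [Set.indicator]
  simp_rw [e1]
  rw [integral_fun_norm_addHaar volume (fun y : ℝ => (Set.Iio A).indicator (fun y : ℝ => y ^ (-2 * a)) y)]
  have e2 : ∫ y in Set.Ioi (0 : ℝ), y ^ (Module.finrank ℝ E2 - 1) • (Set.Iio A).indicator (fun y : ℝ => y ^ (-2 * a)) y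
      = A ^ (2 - 2 * a) / (2 - 2 * a) := by
    have : ∫ y in Set.Ioi (0 : ℝ), y ^ (Module.finrank ℝ E2 - 1) • (Set.Iio A).indicator (fun y : ℝ => y ^ (-2 * a)) y
      = ∫ y in Set.Ioi (0 : ℝ), (Set.Iio A).indicator (fun y : ℝ => y ^ (1 - 2 * a)) y := by
      refine setIntegral_congr_fun measurableSet_Ioi (fun y hy => ?_)
      simp only [finrank_euclideanSpace, Fintype.card_fin, Nat.add_one_sub_one, pow_one, smul_eq_mul, Set.indicator]
      split_ifs
      · rw [sub_eq_add_neg, Real.rpow_add hy, Real.rpow_one]; ring_nf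
      · simp
    rw [this, setIntegral_indicator measurableSet_Iio, Set.Ioi_inter_Iio, ← integral_Ioc_eq_integral_Ioo,
      ← intervalIntegral.integral_of_le hA.le, integral_rpow (Or.inl (by linarith)), Real.zero_rpow (by linarith)]
    ring_nf
  rw [e2]
  simp only [finrank_euclideanSpace, Fintype.card_fin, smul_eq_mul, nsmul_eq_mul]
  apply le_of_eq
  push_cast
  ring

theorem frac_int (s : ℝ) (hs : 0 ≤ s) (F : SchwartzMap E2 ℂ) :
    Integrable (fun ξ => ((‖ξ‖ ^ s : ℝ) : ℂ) * F ξ) ∧ MemLp (fun ξ => ((‖ξ‖ ^ s : ℝ) : ℂ) * F ξ) 2 := by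
  have hc : Continuous (fun ξ : E2 => ((‖ξ‖ ^ s : ℝ) : ℂ) * F ξ) :=
    (Complex.continuous_ofReal.comp (continuous_norm.rpow_const (fun _ => Or.inr hs))).mul F.continuous
  obtain ⟨k, hk⟩ := exists_nat_ge s
  have hb : ∀ x : E2, ‖((‖x‖ ^ s : ℝ) : ℂ) * F x‖ ≤ ‖F x‖ + ‖x‖ ^ k * ‖F x‖ := by
    intro x
    rw [norm_mul, Complex.norm_real, Real.norm_of_nonneg (by positivity)]
    have : ‖x‖ ^ s ≤ 1 + ‖x‖ ^ k := by
      rcases le_total ‖x‖ 1 with h | h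
      · have := Real.rpow_le_one (norm_nonneg x) h hs
        have := pow_nonneg (norm_nonneg x) k
        linarith
      · have := Real.rpow_le_rpow_of_exponent_le h hk
        rw [Real.rpow_natCast] at this
        linarith
    nlinarith [norm_nonneg (F x)]
  have hi : Integrable (fun ξ => ((‖ξ‖ ^ s : ℝ) : ℂ) * F ξ) :=
    ((F.integrable (μ := volume)).norm.add (F.integrable_pow_mul volume k)).mono' hc.aestronglyMeasurable
      (Filter.Eventually.of_forall hb)
  refine ⟨hi, ?_⟩
  obtain ⟨C0, hC0⟩ := F.decay 0 0
  obtain ⟨Ck, hCk⟩ := F.decay k 0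
  have hbd : ∀ x : E2, ‖((‖x‖ ^ s : ℝ) : ℂ) * F x‖ ≤ C0 + Ck := fun x => by
    have h0 := hC0.2 x
    have h1 := hCk.2 x
    simp at h0 h1
    linarith [hb x]
  rw [memLp_two_iff_integrable_sq_norm hc.aestronglyMeasurable]
  refine (hi.norm.const_mul (C0 + Ck)).mono' (hc.norm.pow 2).aestronglyMeasurable
    (Filter.Eventually.of_forall fun x => ?_)
  rw [Real.norm_of_nonneg (by positivity), sq]
  exact mul_le_mul_of_nonneg_right (hbd x) (norm_nonneg _)

theorem low_bound {a K A N : ℝ} (hK : 0 < K) (hA : 0 < A) (hN : 0 < N)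
    (hw : ∫⁻ ξ in Metric.ball (0 : E2) A, ENNReal.ofReal (‖ξ‖ ^ (-2 * a)) ≤
      ENNReal.ofReal (K ^ 2 * A ^ (2 - 2 * a)))
    (h : E2 → ℂ) (hm : Measurable h)
    (hM : ∫⁻ ξ, ENNReal.ofReal (‖ξ‖ ^ (2 * a)) * ‖h ξ‖ₑ ^ (2 : ℝ) ≤ ENNReal.ofReal (N ^ 2)) :
    ∫⁻ ξ in Metric.ball (0 : E2) A, ‖h ξ‖ₑ ≤ ENNReal.ofReal (K * A ^ (1 - a) * N) := by
  have h0 : ∀ᵐ ξ : E2, ξ ≠ 0 := by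
    simp [ae_iff]
  calc ∫⁻ ξ in Metric.ball (0 : E2) A, ‖h ξ‖ₑ
      = ∫⁻ ξ in Metric.ball (0 : E2) A, (ENNReal.ofReal (‖ξ‖ ^ (-2 * a))) ^ (1 / 2 : ℝ) *
          (ENNReal.ofReal (‖ξ‖ ^ (2 * a)) * ‖h ξ‖ₑ ^ (2 : ℝ)) ^ (1 / 2 : ℝ) := by
        apply lintegral_congr_ae
        filter_upwards [ae_restrict_of_ae h0] with ξ hξ
        have hp : 0 < ‖ξ‖ := norm_pos_iff.2 hξ
        rw [ENNReal.mul_rpow_of_nonneg _ _ (by norm_num), ← mul_assoc,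
          ← ENNReal.mul_rpow_of_nonneg _ _ (by norm_num), ← ENNReal.ofReal_mul (by positivity),
          ← Real.rpow_add hp, ← ENNReal.rpow_mul]
        norm_num
    _ ≤ (∫⁻ ξ in Metric.ball (0 : E2) A, (ENNReal.ofReal (‖ξ‖ ^ (-2 * a)))) ^ (1 / 2 : ℝ) *
          (∫⁻ ξ in Metric.ball (0 : E2) A, (ENNReal.ofReal (‖ξ‖ ^ (2 * a)) * ‖h ξ‖ₑ ^ (2 : ℝ))) ^ (1 / 2 : ℝ) := by
        apply ENNReal.lintegral_mul_norm_pow_le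
        · exact (by fun_prop : Measurable _).aemeasurable
        · exact (by fun_prop : Measurable _).aemeasurable
        all_goals norm_num
    _ ≤ (ENNReal.ofReal (K ^ 2 * A ^ (2 - 2 * a))) ^ (1 / 2 : ℝ) * (ENNReal.ofReal (N ^ 2)) ^ (1 / 2 : ℝ) := by
        gcongr
        exact (setLIntegral_le_lintegral _ _).trans hM
    _ = _ := by
        rw [← ENNReal.mul_rpow_of_nonneg _ _ (by norm_num), ← ENNReal.ofReal_mul (by positivity),
          ENNReal.ofReal_rpow_of_nonneg (by positivity) (by norm_num)]
        congr 1
        have : K ^ 2 * A ^ (2 - 2 * a) * N ^ 2 = (K * A ^ (1 - a) * N) ^ 2 := by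
          have : A ^ (2 - 2 * a) = (A ^ (1 - a)) ^ 2 := by
            rw [← Real.rpow_natCast, ← Real.rpow_mul hA.le]; congr 1; push_cast; ring
          rw [this]; ring
        rw [this, ← Real.sqrt_eq_rpow, Real.sqrt_sq (by positivity)]

theorem level_bound {A l : ℝ} (hl : 0 < l) (h : E2 → ℂ) (h1 : Integrable h) (h2 : MemLp h 2)
    (hlow : ∫⁻ ξ in Metric.ball (0 : E2) A, ‖h ξ‖ₑ ≤ ENNReal.ofReal (l / 2)) :
    volume {x | l < ‖(𝓕⁻ h) x‖} ≤ ENNReal.ofReal (4 / l ^ 2) *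
      ∫⁻ ξ in (Metric.ball (0 : E2) A)ᶜ, ‖h ξ‖ₑ ^ (2 : ℝ) := by
  set B := Metric.ball (0 : E2) A with hB
  have mB : MeasurableSet B := measurableSet_ball
  have i1 : Integrable (B.indicator h) := h1.indicator mB
  have i2 : Integrable (Bᶜ.indicator h) := h1.indicator mB.compl
  have m2 : MemLp (Bᶜ.indicator h) 2 := h2.indicator mB.compl
  have hsum : 𝓕⁻ h = 𝓕⁻ (B.indicator h) + 𝓕⁻ (Bᶜ.indicator h) := by
    conv_lhs => rw [← Set.indicator_self_add_compl B h]
    exact (VectorFourier.fourierIntegral_add Real.continuous_fourierChar cont_neg_inner i1 i2)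
  have hsmall : ∀ x, ‖(𝓕⁻ (B.indicator h)) x‖ ≤ l / 2 := by
    intro x
    refine (VectorFourier.norm_fourierIntegral_le_integral_norm _ _ _ _ _).trans ?_
    rw [integral_norm_eq_lintegral_enorm i1.aestronglyMeasurable]
    apply ENNReal.toReal_le_of_le_ofReal (by positivity)
    simp_rw [enorm_indicator_eq_indicator_enorm]
    rw [lintegral_indicator mB]
    exact hlow
  have hcont : Continuous (𝓕⁻ (Bᶜ.indicator h)) :=
    VectorFourier.fourierIntegral_continuous Real.continuous_fourierChar
      (L := -innerₗ E2) cont_neg_inner i2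
  have hsub : {x | l < ‖(𝓕⁻ h) x‖} ⊆ {x | ENNReal.ofReal (l ^ 2 / 4) ≤ ‖(𝓕⁻ (Bᶜ.indicator h)) x‖ₑ ^ (2 : ℝ)} := by
    intro x hx
    simp only [Set.mem_setOf_eq] at hx ⊢
    rw [hsum, Pi.add_apply] at hx
    have := hsmall x
    have := norm_add_le ((𝓕⁻ (B.indicator h)) x) ((𝓕⁻ (Bᶜ.indicator h)) x)
    have h3 : l / 2 ≤ ‖(𝓕⁻ (Bᶜ.indicator h)) x‖ := by linarith
    rw [← ofReal_norm_eq_enorm, ENNReal.ofReal_rpow_of_nonneg (norm_nonneg _) (by norm_num)]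
    apply ENNReal.ofReal_le_ofReal
    rw [Real.rpow_two]
    nlinarith
  have hpl : ∫⁻ x, ‖(𝓕⁻ (Bᶜ.indicator h)) x‖ₑ ^ (2 : ℝ) = ∫⁻ ξ in Bᶜ, ‖h ξ‖ₑ ^ (2 : ℝ) := by
    have := plancherel_aux _ i2 m2
    rw [eLpNorm_eq_lintegral_rpow_enorm_toReal (by norm_num) (by norm_num),
      eLpNorm_eq_lintegral_rpow_enorm_toReal (by norm_num) (by norm_num)] at this
    have h4 := ENNReal.rpow_left_injective (by norm_num) this
    simp only [ENNReal.toReal_ofNat] at h4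
    rw [h4, ← lintegral_indicator mB.compl]
    congr 1
    ext ξ
    by_cases hξ : ξ ∈ Bᶜ
    · rw [Set.indicator_of_mem hξ, Set.indicator_of_mem hξ]
    · rw [Set.indicator_of_notMem hξ, Set.indicator_of_notMem hξ]; simp
  have hch := mul_meas_ge_le_lintegral (μ := volume)
    (f := fun x => ‖(𝓕⁻ (Bᶜ.indicator h)) x‖ₑ ^ (2 : ℝ)) (hcont.measurable.enorm.pow_const _)
    (ENNReal.ofReal (l ^ 2 / 4))
  rw [hpl] at hch
  calc volume {x | l < ‖(𝓕⁻ h) x‖}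
      ≤ volume {x | ENNReal.ofReal (l ^ 2 / 4) ≤ ‖(𝓕⁻ (Bᶜ.indicator h)) x‖ₑ ^ (2 : ℝ)} := measure_mono hsub
    _ = ENNReal.ofReal (4 / l ^ 2) * (ENNReal.ofReal (l ^ 2 / 4) * volume {x | ENNReal.ofReal (l ^ 2 / 4) ≤ ‖(𝓕⁻ (Bᶜ.indicator h)) x‖ₑ ^ (2 : ℝ)}) := by
        rw [← mul_assoc, ← ENNReal.ofReal_mul (by positivity)]
        have : 4 / l ^ 2 * (l ^ 2 / 4) = 1 := by field_simp
        rw [this]; simp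
    _ ≤ _ := by gcongr

theorem sobolev_aux {p : ℝ} (hp : 2 < p) : ∃ C > 0, ∀ h : E2 → ℂ, Measurable h → Integrable h → MemLp h 2 →
    ∀ N : ℝ, 0 < N →
    ∫⁻ ξ, ENNReal.ofReal (‖ξ‖ ^ (2 * (1 - 2 / p))) * ‖h ξ‖ₑ ^ (2 : ℝ) ≤ ENNReal.ofReal (N ^ 2) →
    ∫⁻ x, ENNReal.ofReal (‖(𝓕⁻ h) x‖ ^ p) ≤ ENNReal.ofReal (C * N ^ p) := by
  have hp0 : 0 < p := by linarith
  set a := 1 - 2 / p with ha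
  have ha1 : a < 1 := by
    have : 0 < 2 / p := by positivity
    linarith
  obtain ⟨K, hK, hw⟩ := weight_lint ha1
  refine ⟨p * (4 * ((2 * K) ^ (p - 2) / (p - 2))), ?_, ?_⟩
  · have : 0 < p - 2 := by linarith
    positivity
  intro h hm h1 h2 N hN hM
  have hcont : Continuous (𝓕⁻ h) :=
    VectorFourier.fourierIntegral_continuous Real.continuous_fourierChar
      (L := -innerₗ E2) cont_neg_inner h1
  rw [lintegral_rpow_eq_lintegral_meas_lt_mul volume (Filter.Eventually.of_forall fun x => norm_nonneg _)
    hcont.norm.measurable.aemeasurable hp0]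
  set T : E2 → ℝ := fun ξ => 2 * K * N * ‖ξ‖ ^ (2 / p) with hT
  have hTm : Measurable T := by fun_prop
  have hT0 : ∀ ξ, 0 ≤ T ξ := fun ξ => by positivity
  have step : ∀ t ∈ Set.Ioi (0 : ℝ), volume {x | t < ‖(𝓕⁻ h) x‖} * ENNReal.ofReal (t ^ (p - 1)) ≤
      ∫⁻ ξ, (if t ≤ T ξ then ENNReal.ofReal (4 * t ^ (p - 3)) * ‖h ξ‖ₑ ^ (2 : ℝ) else 0) := by
    intro t ht
    have ht : 0 < t := ht
    set A := (t / (2 * K * N)) ^ (p / 2) with hA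
    have hA0 : 0 < A := by positivity
    have hAt : 2 * K * N * A ^ (2 / p) = t := by
      rw [hA, ← Real.rpow_mul (by positivity)]
      have : p / 2 * (2 / p) = 1 := by field_simp
      rw [this, Real.rpow_one]; field_simp
    have hl := low_bound hK hA0 hN (hw A hA0) h hm hM
    have e : K * A ^ (1 - a) * N = t / 2 := by
      have : 1 - a = 2 / p := by rw [ha]; ring
      rw [this]; linarith
    rw [e] at hl
    have hlev := level_bound ht h h1 h2 hl
    calc _ ≤ ENNReal.ofReal (4 / t ^ 2) * (∫⁻ ξ in (Metric.ball (0 : E2) A)ᶜ, ‖h ξ‖ₑ ^ (2 : ℝ)) * ENNReal.ofReal (t ^ (p - 1)) := by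
          gcongr
      _ = ENNReal.ofReal (4 * t ^ (p - 3)) * (∫⁻ ξ in (Metric.ball (0 : E2) A)ᶜ, ‖h ξ‖ₑ ^ (2 : ℝ)) := by
          rw [mul_right_comm, ← ENNReal.ofReal_mul (by positivity)]
          congr 2
          have : t ^ (p - 1) = t ^ (p - 3) * t ^ 2 := by
            rw [← Real.rpow_natCast t 2, ← Real.rpow_add ht]; congr 1; push_cast; ring
          rw [this]; field_simp
      _ = ∫⁻ ξ in (Metric.ball (0 : E2) A)ᶜ, ENNReal.ofReal (4 * t ^ (p - 3)) * ‖h ξ‖ₑ ^ (2 : ℝ) := by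
          rw [lintegral_const_mul _ (by fun_prop)]
      _ ≤ _ := by
          rw [← lintegral_indicator measurableSet_ball.compl]
          apply lintegral_mono
          intro ξ
          by_cases hξ : ξ ∈ (Metric.ball (0 : E2) A)ᶜ
          · have : t ≤ T ξ := by
              have h5 : A ≤ ‖ξ‖ := by simpa using hξ
              rw [← hAt, hT]
              dsimp only
              gcongr
            rw [Set.indicator_of_mem hξ]
            simp only [this, if_true, le_refl]
          · rw [Set.indicator_of_notMem hξ]; simp
  calc ENNReal.ofReal p * ∫⁻ t in Set.Ioi 0, volume {x | t < ‖(𝓕⁻ h) x‖} * ENNReal.ofReal (t ^ (p - 1))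
      ≤ ENNReal.ofReal p * ∫⁻ t in Set.Ioi 0,
        ∫⁻ ξ, (if t ≤ T ξ then ENNReal.ofReal (4 * t ^ (p - 3)) * ‖h ξ‖ₑ ^ (2 : ℝ) else 0) := by
        exact mul_le_mul_right (setLIntegral_mono' measurableSet_Ioi step) _
    _ = ENNReal.ofReal p * ∫⁻ ξ, ∫⁻ t in Set.Ioi 0,
         (if t ≤ T ξ then ENNReal.ofReal (4 * t ^ (p - 3)) * ‖h ξ‖ₑ ^ (2 : ℝ) else 0) := by
        rw [lintegral_lintegral_swap]
        apply Measurable.aemeasurable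
        apply Measurable.ite
        · exact measurableSet_le measurable_fst (hTm.comp measurable_snd)
        · fun_prop
        · fun_prop
    _ = ENNReal.ofReal p * ∫⁻ ξ, ENNReal.ofReal (4 * ((2 * K * N) ^ (p - 2) / (p - 2))) *
          (ENNReal.ofReal (‖ξ‖ ^ (2 * a)) * ‖h ξ‖ₑ ^ (2 : ℝ)) := by
        congr 1
        apply lintegral_congr
        intro ξ
        calc _ = ∫⁻ t in Set.Ioi 0, (Set.Iic (T ξ)).indicator
                  (fun t => ENNReal.ofReal 4 * ‖h ξ‖ₑ ^ (2 : ℝ) * ENNReal.ofReal (t ^ (p - 3))) t := by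
              apply setLIntegral_congr_fun measurableSet_Ioi
              intro t ht
              simp only [Set.indicator, Set.mem_Iic]
              split_ifs
              · rw [ENNReal.ofReal_mul (by norm_num)]; ring
              · rfl
          _ = ENNReal.ofReal 4 * ‖h ξ‖ₑ ^ (2 : ℝ) * ENNReal.ofReal (T ξ ^ (p - 2) / (p - 2)) := by
              rw [setLIntegral_indicator measurableSet_Iic, Set.inter_comm, Set.Ioi_inter_Iic,
                lintegral_const_mul _ (by fun_prop), rpow_lint (by linarith) (hT0 ξ)]
              ring_nf
          _ = _ := by
              have : T ξ ^ (p - 2) = (2 * K * N) ^ (p - 2) * ‖ξ‖ ^ (2 * a) := by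
                rw [hT]
                dsimp only
                rw [Real.mul_rpow (by positivity) (by positivity), ← Real.rpow_mul (norm_nonneg _)]
                congr 2
                rw [ha]; field_simp
              rw [this, mul_right_comm, ← ENNReal.ofReal_mul (by norm_num), ← mul_assoc,
                ← ENNReal.ofReal_mul]
              · ring_nf
              · have : 0 < p - 2 := by linarith
                positivity
    _ = ENNReal.ofReal p * (ENNReal.ofReal (4 * ((2 * K * N) ^ (p - 2) / (p - 2))) *
          ∫⁻ ξ, (ENNReal.ofReal (‖ξ‖ ^ (2 * a)) * ‖h ξ‖ₑ ^ (2 : ℝ))) := by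
        rw [lintegral_const_mul _ (by fun_prop)]
    _ ≤ ENNReal.ofReal p * (ENNReal.ofReal (4 * ((2 * K * N) ^ (p - 2) / (p - 2))) * ENNReal.ofReal (N ^ 2)) := by
        gcongr
    _ = _ := by
        have h2p : 0 < p - 2 := by linarith
        rw [← ENNReal.ofReal_mul (by positivity), ← ENNReal.ofReal_mul (by positivity)]
        congr 1
        have : N ^ p = N ^ (p - 2) * N ^ 2 := by
          rw [← Real.rpow_natCast N 2, ← Real.rpow_add hN]; congr 1; push_cast; ring
        rw [this, Real.mul_rpow (by positivity) (by positivity)]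
        ring

theorem sobolev_norm {p : ℝ} (hp : 2 < p) : ∃ C > 0, ∀ h : E2 → ℂ, Measurable h → Integrable h → MemLp h 2 →
    eLpNorm (𝓕⁻ h) (ENNReal.ofReal p) volume ≤ ENNReal.ofReal C *
      (∫⁻ ξ, ENNReal.ofReal (‖ξ‖ ^ (2 * (1 - 2 / p))) * ‖h ξ‖ₑ ^ (2 : ℝ)) ^ (1 / 2 : ℝ) := by
  obtain ⟨C, hC, H⟩ := sobolev_aux hp
  have hp0 : 0 < p := by linarith
  refine ⟨C ^ (1 / p), by positivity, fun h hm h1 h2 => ?_⟩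
  set M := ∫⁻ ξ, ENNReal.ofReal (‖ξ‖ ^ (2 * (1 - 2 / p))) * ‖h ξ‖ₑ ^ (2 : ℝ) with hMdef
  have key : ∀ N : ℝ, 0 < N → M ≤ ENNReal.ofReal (N ^ 2) →
      eLpNorm (𝓕⁻ h) (ENNReal.ofReal p) volume ≤ ENNReal.ofReal (C ^ (1 / p)) * ENNReal.ofReal N := by
    intro N hN hM
    have h3 := H h hm h1 h2 N hN hM
    rw [eLpNorm_eq_lintegral_rpow_enorm_toReal (by simpa using hp0) (by simp), ENNReal.toReal_ofReal hp0.le]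
    have e : ∫⁻ x, ‖(𝓕⁻ h) x‖ₑ ^ p = ∫⁻ x, ENNReal.ofReal (‖(𝓕⁻ h) x‖ ^ p) := by
      apply lintegral_congr
      intro x
      rw [← ofReal_norm_eq_enorm, ENNReal.ofReal_rpow_of_nonneg (norm_nonneg _) hp0.le]
    rw [e]
    calc _ ≤ (ENNReal.ofReal (C * N ^ p)) ^ (1 / p) := by gcongr
      _ = _ := by
        rw [ENNReal.ofReal_rpow_of_nonneg (by positivity) (by positivity), ← ENNReal.ofReal_mul (by positivity),
          Real.mul_rpow (by positivity) (by positivity), ← Real.rpow_mul hN.le]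
        have : p * (1 / p) = 1 := by field_simp
        rw [this, Real.rpow_one]
  have hCne : ENNReal.ofReal (C ^ (1 / p)) ≠ 0 := by
    have : 0 < C ^ (1 / p) := by positivity
    simpa using this
  rcases eq_or_ne M ⊤ with hMt | hMt
  · rw [hMt, ENNReal.top_rpow_of_pos (by norm_num), ENNReal.mul_top hCne]
    exact le_top
  rcases eq_or_ne M 0 with hM0 | hM0
  · have : eLpNorm (𝓕⁻ h) (ENNReal.ofReal p) volume ≤ 0 := by
      have hlim : Filter.Tendsto (fun N : ℝ => ENNReal.ofReal (C ^ (1 / p)) * ENNReal.ofReal N)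
          (nhdsWithin 0 (Set.Ioi 0)) (nhds (ENNReal.ofReal (C ^ (1 / p)) * ENNReal.ofReal 0)) := by
        apply ENNReal.Tendsto.const_mul _ (Or.inr ENNReal.ofReal_ne_top)
        exact (ENNReal.continuous_ofReal.tendsto 0).mono_left nhdsWithin_le_nhds
      rw [ENNReal.ofReal_zero, mul_zero] at hlim
      apply ge_of_tendsto hlim
      filter_upwards [self_mem_nhdsWithin] with N hN
      exact key N hN (by rw [hM0]; exact zero_le)
    exact this.trans zero_le
  · have hMp : 0 < M.toReal := ENNReal.toReal_pos hM0 hMt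
    have h4 := key (M.toReal ^ (1 / 2 : ℝ)) (by positivity) (by
      rw [← Real.rpow_natCast, ← Real.rpow_mul hMp.le]
      norm_num
      rw [ENNReal.ofReal_toReal hMt])
    rwa [← ENNReal.ofReal_rpow_of_nonneg hMp.le (by norm_num), ENNReal.ofReal_toReal hMt] at h4

theorem enorm_frac_sq (r : ℝ) (F : E2 → ℂ) (ξ : E2) :
    ‖((‖ξ‖ ^ r : ℝ) : ℂ) * F ξ‖ₑ ^ (2 : ℝ) = ENNReal.ofReal (‖ξ‖ ^ (2 * r)) * ‖F ξ‖ₑ ^ (2 : ℝ) := by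
  rw [enorm_mul, ENNReal.mul_rpow_of_nonneg _ _ (by norm_num)]
  congr 1
  rw [← ofReal_norm_eq_enorm, Complex.norm_real, Real.norm_of_nonneg (by positivity),
    ENNReal.ofReal_rpow_of_nonneg (by positivity) (by norm_num), ← Real.rpow_mul (norm_nonneg _), mul_comm]

theorem norm_fracLap (r : ℝ) (hr : 0 ≤ r) (f : SchwartzMap E2 ℂ) :
    eLpNorm (fracLap r f) 2 volume =
      (∫⁻ ξ, ENNReal.ofReal (‖ξ‖ ^ (2 * r)) * ‖(𝓕 f) ξ‖ₑ ^ (2 : ℝ)) ^ (1 / 2 : ℝ) := by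
  have hi := frac_int r hr (𝓕 f)
  have := plancherel_aux _ hi.1 hi.2
  unfold fracLap
  rw [← SchwartzMap.fourier_coe, this, eLpNorm_eq_lintegral_rpow_enorm_toReal (by norm_num) (by norm_num)]
  simp only [ENNReal.toReal_ofNat, enorm_frac_sq]

theorem interp_aux {r s₁ s₂ θ : ℝ} (h0 : 0 ≤ θ) (h1 : θ ≤ 1) (hr : r = s₁ * (1 - θ) + θ * s₂)
    (F : E2 → ℂ) (hF : Measurable F) :
    ∫⁻ ξ, ENNReal.ofReal (‖ξ‖ ^ (2 * r)) * ‖F ξ‖ₑ ^ (2 : ℝ) ≤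
      (∫⁻ ξ, ENNReal.ofReal (‖ξ‖ ^ (2 * s₁)) * ‖F ξ‖ₑ ^ (2 : ℝ)) ^ (1 - θ) *
      (∫⁻ ξ, ENNReal.ofReal (‖ξ‖ ^ (2 * s₂)) * ‖F ξ‖ₑ ^ (2 : ℝ)) ^ θ := by
  have hne : ∀ᵐ ξ : E2, ξ ≠ 0 := by
    simp [ae_iff]
  refine le_trans (le_of_eq ?_) (ENNReal.lintegral_mul_norm_pow_le (p := 1 - θ) (q := θ)
    (by fun_prop) (by fun_prop) (by linarith) h0 (by ring))
  apply lintegral_congr_ae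
  filter_upwards [hne] with ξ hξ
  have hp : 0 < ‖ξ‖ := norm_pos_iff.2 hξ
  rw [ENNReal.mul_rpow_of_nonneg _ _ (by linarith), ENNReal.mul_rpow_of_nonneg _ _ h0, mul_mul_mul_comm,
    ← ENNReal.rpow_add_of_nonneg _ _ (by linarith) h0, ENNReal.ofReal_rpow_of_nonneg (by positivity) (by linarith),
    ENNReal.ofReal_rpow_of_nonneg (by positivity) h0, ← ENNReal.ofReal_mul (by positivity),
    ← Real.rpow_mul hp.le, ← Real.rpow_mul hp.le, ← Real.rpow_add hp, sub_add_cancel, ENNReal.rpow_one, hr]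
  ring_nf

theorem sobolev_frac {p s : ℝ} (hp : 2 ≤ p) (hs : 0 ≤ s) : ∃ C > 0, ∀ f : SchwartzMap E2 ℂ,
    eLpNorm (fracLap s f) (ENNReal.ofReal p) volume ≤ ENNReal.ofReal C *
      (∫⁻ ξ, ENNReal.ofReal (‖ξ‖ ^ (2 * (s + 1 - 2 / p))) * ‖(𝓕 f) ξ‖ₑ ^ (2 : ℝ)) ^ (1 / 2 : ℝ) := by
  rcases hp.eq_or_lt with rfl | hp
  · refine ⟨1, one_pos, fun f => ?_⟩
    have := norm_fracLap s hs f
    simp only [ENNReal.ofReal_ofNat, this]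
    norm_num
  · obtain ⟨C, hC, H⟩ := sobolev_norm hp
    refine ⟨C, hC, fun f => ?_⟩
    have hi := frac_int s hs (𝓕 f)
    have hm : Measurable (fun ξ : E2 => ((‖ξ‖ ^ s : ℝ) : ℂ) * (𝓕 f) ξ) := by
      have := (𝓕 f).continuous.measurable
      fun_prop
    refine (le_of_eq ?_).trans ((H _ hm hi.1 hi.2).trans (le_of_eq ?_))
    · unfold fracLap
      rw [← SchwartzMap.fourier_coe]
    · congr 2
      apply lintegral_congr
      intro ξ
      have ha : 0 ≤ 1 - 2 / p := by
        have : 2 / p ≤ 1 := by rw [div_le_one (by linarith)]; exact hp.le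
        linarith
      rw [enorm_frac_sq, ← mul_assoc, ← ENNReal.ofReal_mul (by positivity),
        ← Real.rpow_add_of_nonneg (norm_nonneg _) (by linarith) (by linarith)]
      ring_nf

end GNHelpers

/-- Gagliardo-Nirenberg inequality in dimension 2: for `p ∈ [2,∞)`, `0 ≤ s, s₁ ≤ s₂`,
`s₁ ≤ s`, `θ ∈ [0,1]` with `s + 1 - 2/p = s₁(1-θ) + θ s₂`, there is `C` with
`‖Λ^s f‖_{L^p} ≤ C ‖Λ^{s₁} f‖_{L²}^{1-θ} ‖Λ^{s₂} f‖_{L²}^θ` for all Schwartz `f`. -/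
theorem stmt_5 (p s s₁ s₂ θ : ℝ) (hp : 2 ≤ p) (hs : 0 ≤ s) (hs₁ : 0 ≤ s₁)
    (hs₁s : s₁ ≤ s) (hs₁₂ : s₁ ≤ s₂) (hθ : θ ∈ Set.Icc (0 : ℝ) 1)
    (hbal : s + 1 - 2 / p = s₁ * (1 - θ) + θ * s₂) :
    ∃ C > 0, ∀ f : SchwartzMap (EuclideanSpace ℝ (Fin 2)) ℂ,
      eLpNorm (fracLap s f) (ENNReal.ofReal p) volume ≤
        ENNReal.ofReal C * (eLpNorm (fracLap s₁ f) 2 volume) ^ (1 - θ) *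
          (eLpNorm (fracLap s₂ f) 2 volume) ^ θ := by
  obtain ⟨C, hC, H⟩ := sobolev_frac hp hs
  refine ⟨C, hC, fun f => (H f).trans ?_⟩
  rw [norm_fracLap s₁ hs₁ f, norm_fracLap s₂ (hs₁.trans hs₁₂) f, mul_assoc,
    ← ENNReal.rpow_mul, ← ENNReal.rpow_mul, mul_comm (1 / 2 : ℝ) (1 - θ), mul_comm (1 / 2 : ℝ) θ,
    ENNReal.rpow_mul, ENNReal.rpow_mul, ← ENNReal.mul_rpow_of_nonneg _ _ (by norm_num : (0 : ℝ) ≤ 1 / 2)]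
  gcongr
  exact interp_aux hθ.1 hθ.2 hbal _ (𝓕 f).continuous.measurable
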